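/- Store weakening for realizers: for any pole ⊥⊥ and any simple type A of the λ̄[lvτ⋆]-calculus, if τ ◁ τ′ are closed stores and (t|τ) ∈ |A|_t, then (t|τ′) ∈ |A|_t; and the analogous statement holds at each of the levels e, E, V, F, v of the realizability interpretation. -/

import Mathlib

namespace LLV

/-- Simple types: atomic types (indexed by naturals) and arrows. -/
inductive Ty : Type
  | atom : ℕ → Ty
  | arrow : Ty → Ty → Ty
deriving DecidableEq

/- Syntax of the λ̄[lvτ⋆]-calculus, by mutual induction. -/
mutual
/-- Strong values v ::= λx.t | 𝐤 -/
inductive SVal : Type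
  | lam : ℕ → Trm → SVal
  | const : ℕ → SVal
/-- Weak values V ::= v | x -/
inductive WVal : Type
  | sval : SVal → WVal
  | var : ℕ → WVal
/-- Terms t ::= V | μα.c -/
inductive Trm : Type
  | wval : WVal → Trm
  | mu : ℕ → Cmd → Trm
/-- Forcing contexts F ::= t·E | 𝛋 -/
inductive FCtx : Type
  | app : Trm → CCtx → FCtx
  | coconst : ℕ → FCtx
/-- Catchable contexts E ::= F | α | μ̃[x].⟨x‖F⟩τ -/
inductive CCtx : Type
  | fctx : FCtx → CCtx
  | covar : ℕ → CCtx
  | mutil : ℕ → FCtx → Store → CCtx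
/-- Evaluation contexts e ::= E | μ̃x.c -/
inductive ECtx : Type
  | cctx : CCtx → ECtx
  | mut : ℕ → Cmd → ECtx
/-- Commands c ::= ⟨t‖e⟩ -/
inductive Cmd : Type
  | cut : Trm → ECtx → Cmd
/-- Stores τ ::= ε | τ[x:=t] | τ[α:=E] -/
inductive Store : Type
  | nil : Store
  | consT : Store → ℕ → Trm → Store
  | consE : Store → ℕ → CCtx → Store
end

/-- Coercion: weak value to term. -/
def ofW (V : WVal) : Trm := .wval V
/-- Coercion: strong value to term. -/
def ofS (v : SVal) : Trm := .wval (.sval v)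
/-- Coercion: catchable context to evaluation context. -/
def ofC (E : CCtx) : ECtx := .cctx E
/-- Coercion: forcing context to evaluation context. -/
def ofF (F : FCtx) : ECtx := .cctx (.fctx F)

/-- Domain of a store: the set of (co-)variables it binds
(term variables on the left, context variables on the right). -/
def Store.dom : Store → Finset (ℕ ⊕ ℕ)
  | .nil => ∅
  | .consT τ x _ => insert (Sum.inl x) τ.dom
  | .consE τ α _ => insert (Sum.inr α) τ.dom

mutual
def SVal.fv : SVal → Finset (ℕ ⊕ ℕ)
  | .lam x t => t.fv \ {Sum.inl x}
  | .const _ => ∅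
def WVal.fv : WVal → Finset (ℕ ⊕ ℕ)
  | .sval v => v.fv
  | .var x => {Sum.inl x}
def Trm.fv : Trm → Finset (ℕ ⊕ ℕ)
  | .wval V => V.fv
  | .mu α c => c.fv \ {Sum.inr α}
def FCtx.fv : FCtx → Finset (ℕ ⊕ ℕ)
  | .app t E => t.fv ∪ E.fv
  | .coconst _ => ∅
def CCtx.fv : CCtx → Finset (ℕ ⊕ ℕ)
  | .fctx F => F.fv
  | .covar α => {Sum.inr α}
  | .mutil x F τ => (τ.fv ∪ (F.fv \ τ.dom)) \ {Sum.inl x}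
def ECtx.fv : ECtx → Finset (ℕ ⊕ ℕ)
  | .cctx E => E.fv
  | .mut x c => c.fv \ {Sum.inl x}
def Cmd.fv : Cmd → Finset (ℕ ⊕ ℕ)
  | .cut t e => t.fv ∪ e.fv
def Store.fv : Store → Finset (ℕ ⊕ ℕ)
  | .nil => ∅
  | .consT τ x t => τ.fv ∪ (t.fv \ τ.dom)
  | .consE τ α E => τ.fv ∪ (E.fv \ τ.dom)
end

/-- Concatenation ττ′ of stores. -/
def Store.app : Store → Store → Store
  | τ, .nil => τ
  | τ, .consT τ' x t => .consT (τ.app τ') x t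
  | τ, .consE τ' α E => .consE (τ.app τ') α E

/-- Lookup of the (most recent) binding of a (co-)variable in a store. -/
def Store.lookup : Store → ℕ ⊕ ℕ → Option (Trm ⊕ CCtx)
  | .nil, _ => none
  | .consT τ x t, k => if k = Sum.inl x then some (Sum.inl t) else τ.lookup k
  | .consE τ α E, k => if k = Sum.inr α then some (Sum.inr E) else τ.lookup k

/-- A store is closed when it has no free variable. -/
def Store.Closed (τ : Store) : Prop := τ.fv = ∅

/-- Compatibility τ◇τ′: the bindings of τ and τ′ coincide on dom(τ)∩dom(τ′). -/
def Compat (τ τ' : Store) : Prop :=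
  ∀ k, k ∈ τ.dom → k ∈ τ'.dom → τ.lookup k = τ'.lookup k

/-- Store extension τ◁τ′: dom(τ)⊆dom(τ′) and τ◇τ′. -/
def Ext (τ τ' : Store) : Prop := τ.dom ⊆ τ'.dom ∧ Compat τ τ'

/-- A single binding of a store. -/
inductive Bnd : Type
  | bt : ℕ → Trm → Bnd
  | be : ℕ → CCtx → Bnd

def Bnd.key : Bnd → ℕ ⊕ ℕ
  | .bt x _ => Sum.inl x
  | .be α _ => Sum.inr α

/-- The list of bindings of a store, oldest first. -/
def Store.toL : Store → List Bnd
  | .nil => []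
  | .consT τ x t => τ.toL ++ [.bt x t]
  | .consE τ α E => τ.toL ++ [.be α E]

/-- Rebuild a store from its list of bindings (oldest first). -/
def Store.ofL : List Bnd → Store :=
  List.foldl (fun τ b => match b with
    | .bt x t => .consT τ x t
    | .be α E => .consE τ α E) .nil

/-- Split a list of bindings at the first binding of the given key,
returning the (strict) prefix and the suffix. -/
def splitAtKey (k : ℕ ⊕ ℕ) : List Bnd → Option (List Bnd × List Bnd)
  | [] => none
  | b :: l =>
    if b.key = k then some ([], l)
    else (splitAtKey k l).map (fun p => (b :: p.1, p.2))

/-- The compatible union on lists of bindings: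
(τ₀[x:=t]τ₁)⋈(τ₀′[x:=t]τ₁′) = τ₀τ₀′[x:=t](τ₁⋈τ₁′) when τ₀#τ₀′,
and τ⋈τ′ = ττ′ when τ#τ′. -/
def joinL : List Bnd → List Bnd → List Bnd
  | [], l' => l'
  | b :: l, l' =>
    match splitAtKey b.key l' with
    | some (p, s) => p ++ b :: joinL l s
    | none => b :: joinL l l'

/-- The compatible union τ̄τ′ of two (compatible closed) stores. -/
def Store.join (τ τ' : Store) : Store := .ofL (joinL τ.toL τ'.toL)

/-- Closures cτ. -/
abbrev Closure := Cmd × Store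

/-- The reduction → of the λ̄[lvτ⋆]-calculus. -/
inductive Red : Closure → Closure → Prop
  | beta (x : ℕ) (t u : Trm) (E : CCtx) (τ : Store) :
      Red (.cut (ofS (.lam x t)) (ofF (.app u E)), τ)
          (.cut u (.mut x (.cut t (ofC E))), τ)
  | lett (t : Trm) (x : ℕ) (c : Cmd) (τ : Store) :
      Red (.cut t (.mut x c), τ) (c, .consT τ x t)
  | catch (α : ℕ) (c : Cmd) (E : CCtx) (τ : Store) :
      Red (.cut (.mu α c) (ofC E), τ) (c, .consE τ α E)
  | lookupA (V : WVal) (α : ℕ) (E : CCtx) (τ τ' : Store) :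
      Red (.cut (ofW V) (ofC (.covar α)), (Store.consE τ α E).app τ')
          (.cut (ofW V) (ofC E), (Store.consE τ α E).app τ')
  | lookupX (x : ℕ) (F : FCtx) (t : Trm) (τ τ' : Store) :
      Red (.cut (ofW (.var x)) (ofF F), (Store.consT τ x t).app τ')
          (.cut t (ofC (.mutil x F τ')), τ)
  | restore (V : WVal) (x : ℕ) (F : FCtx) (τ τ' : Store) :
      Red (.cut (ofW V) (ofC (.mutil x F τ')), τ)
          (.cut (ofW V) (ofF F), (Store.consT τ x (ofW V)).app τ')

/-- A closure normalizes when there is no infinite reduction sequence from it. -/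
def Normalizes (l : Closure) : Prop :=
  ¬ ∃ f : ℕ → Closure, f 0 = l ∧ ∀ n, Red (f n) (f (n + 1))

/-- Closed closures: the store is closed and covers the free variables
of the command. -/
def InC0 (l : Closure) : Prop := l.2.Closed ∧ l.1.fv ⊆ l.2.dom

/-- Entries of typing contexts: x:A or α:A⊥⊥. -/
inductive CEntry : Type
  | tv : ℕ → Ty → CEntry
  | cv : ℕ → Ty → CEntry
deriving DecidableEq

/-- Typing contexts Γ (as lists, written left to right). -/
abbrev Ctx := List CEntry

/- The typing judgments, parameterized by signatures cs (constants) and ks (co-constants). -/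
mutual
inductive Tv (cs : ℕ → ℕ) (ks : ℕ → Ty) : Ctx → SVal → Ty → Prop
  | const {Γ : Ctx} (k : ℕ) : Tv cs ks Γ (.const k) (.atom (cs k))
  | lam {Γ : Ctx} {x : ℕ} {t : Trm} {A B : Ty} :
      Tt cs ks (Γ ++ [.tv x A]) t B → Tv cs ks Γ (.lam x t) (.arrow A B)
inductive TV (cs : ℕ → ℕ) (ks : ℕ → Ty) : Ctx → WVal → Ty → Prop
  | var {Γ : Ctx} {x : ℕ} {A : Ty} : CEntry.tv x A ∈ Γ → TV cs ks Γ (.var x) A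
  | sval {Γ : Ctx} {v : SVal} {A : Ty} : Tv cs ks Γ v A → TV cs ks Γ (.sval v) A
inductive Tt (cs : ℕ → ℕ) (ks : ℕ → Ty) : Ctx → Trm → Ty → Prop
  | wval {Γ : Ctx} {V : WVal} {A : Ty} : TV cs ks Γ V A → Tt cs ks Γ (.wval V) A
  | mu {Γ : Ctx} {α : ℕ} {c : Cmd} {A : Ty} :
      Tc cs ks (Γ ++ [.cv α A]) c → Tt cs ks Γ (.mu α c) A
inductive TF (cs : ℕ → ℕ) (ks : ℕ → Ty) : Ctx → FCtx → Ty → Prop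
  | coconst {Γ : Ctx} (κ : ℕ) : TF cs ks Γ (.coconst κ) (ks κ)
  | app {Γ : Ctx} {t : Trm} {E : CCtx} {A B : Ty} :
      Tt cs ks Γ t A → TE cs ks Γ E B → TF cs ks Γ (.app t E) (.arrow A B)
inductive TE (cs : ℕ → ℕ) (ks : ℕ → Ty) : Ctx → CCtx → Ty → Prop
  | covar {Γ : Ctx} {α : ℕ} {A : Ty} : CEntry.cv α A ∈ Γ → TE cs ks Γ (.covar α) A
  | fctx {Γ : Ctx} {F : FCtx} {A : Ty} : TF cs ks Γ F A → TE cs ks Γ (.fctx F) A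
  | mutil {Γ Γ' : Ctx} {x : ℕ} {F : FCtx} {τ : Store} {A : Ty} :
      TF cs ks (Γ ++ [.tv x A] ++ Γ') F A → Tτ cs ks Γ τ Γ' →
      TE cs ks Γ (.mutil x F τ) A
inductive Te (cs : ℕ → ℕ) (ks : ℕ → Ty) : Ctx → ECtx → Ty → Prop
  | cctx {Γ : Ctx} {E : CCtx} {A : Ty} : TE cs ks Γ E A → Te cs ks Γ (.cctx E) A
  | mut {Γ : Ctx} {x : ℕ} {c : Cmd} {A : Ty} :
      Tc cs ks (Γ ++ [.tv x A]) c → Te cs ks Γ (.mut x c) A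
inductive Tc (cs : ℕ → ℕ) (ks : ℕ → Ty) : Ctx → Cmd → Prop
  | cut {Γ : Ctx} {t : Trm} {e : ECtx} {A : Ty} :
      Tt cs ks Γ t A → Te cs ks Γ e A → Tc cs ks Γ (.cut t e)
inductive Tτ (cs : ℕ → ℕ) (ks : ℕ → Ty) : Ctx → Store → Ctx → Prop
  | nil {Γ : Ctx} : Tτ cs ks Γ .nil []
  | consT {Γ Γ' : Ctx} {τ : Store} {x : ℕ} {t : Trm} {A : Ty} :
      Tτ cs ks Γ τ Γ' → Tt cs ks (Γ ++ Γ') t A →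
      Tτ cs ks Γ (.consT τ x t) (Γ' ++ [.tv x A])
  | consE {Γ Γ' : Ctx} {τ : Store} {α : ℕ} {E : CCtx} {A : Ty} :
      Tτ cs ks Γ τ Γ' → TE cs ks (Γ ++ Γ') E A →
      Tτ cs ks Γ (.consE τ α E) (Γ' ++ [.cv α A])
end

/-- Judgment Γ ⊢l cτ for closures. -/
def Tl (cs : ℕ → ℕ) (ks : ℕ → Ty) (Γ : Ctx) (c : Cmd) (τ : Store) : Prop :=
  ∃ Γ', Tc cs ks (Γ ++ Γ') c ∧ Tτ cs ks Γ τ Γ'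

/- No occurrence of a co-constant. -/
mutual
def SVal.noco : SVal → Prop
  | .lam _ t => t.noco
  | .const _ => True
def WVal.noco : WVal → Prop
  | .sval v => v.noco
  | .var _ => True
def Trm.noco : Trm → Prop
  | .wval V => V.noco
  | .mu _ c => c.noco
def FCtx.noco : FCtx → Prop
  | .app t E => t.noco ∧ E.noco
  | .coconst _ => False
def CCtx.noco : CCtx → Prop
  | .fctx F => F.noco
  | .covar _ => True
  | .mutil _ F τ => F.noco ∧ τ.noco
def ECtx.noco : ECtx → Prop
  | .cctx E => E.noco
  | .mut _ c => c.noco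
def Cmd.noco : Cmd → Prop
  | .cut t e => t.noco ∧ e.noco
def Store.noco : Store → Prop
  | .nil => True
  | .consT τ _ t => τ.noco ∧ t.noco
  | .consE τ _ E => τ.noco ∧ E.noco
end

/-- A pole: a set of closed closures closed by anti-reduction and
by store extension. -/
structure Pole where
  mem : Closure → Prop
  mem_c0 : ∀ l, mem l → InC0 l
  anti : ∀ l l', InC0 l → InC0 l' → Red l l' → mem l' → mem l
  store_ext : ∀ c τ τ', mem (c, τ) → Ext τ τ' → Store.Closed τ' → mem (c, τ')

/-- Orthogonality (t|τ)⊥⊥(e|τ′): τ◇τ′ and ⟨t‖e⟩(τ̄τ′)∈⊥⊥. -/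
def Pole.ortho (P : Pole) (t : Trm) (τ : Store) (e : ECtx) (τ' : Store) : Prop :=
  Compat τ τ' ∧ P.mem (.cut t e, τ.join τ')

/-- The pair is a closed (term/context)-in-store: τ is closed and covers fv. -/
def CT (fv : Finset (ℕ ⊕ ℕ)) (τ : Store) : Prop := τ.Closed ∧ fv ⊆ τ.dom

/-- Forcing contexts orthogonal to a set of strong values. -/
def orthFv (P : Pole) (S : Set (SVal × Store)) : Set (FCtx × Store) :=
  {Fτ | CT Fτ.1.fv Fτ.2 ∧
    ∀ v τ', (v, τ') ∈ S → Compat Fτ.2 τ' → P.ortho (ofS v) τ' (ofF Fτ.1) Fτ.2}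

/-- Weak values orthogonal to a set of forcing contexts. -/
def orthVF (P : Pole) (S : Set (FCtx × Store)) : Set (WVal × Store) :=
  {Vτ | CT Vτ.1.fv Vτ.2 ∧
    ∀ F τ', (F, τ') ∈ S → Compat Vτ.2 τ' → P.ortho (ofW Vτ.1) Vτ.2 (ofF F) τ'}

/-- Catchable contexts orthogonal to a set of weak values. -/
def orthEV (P : Pole) (S : Set (WVal × Store)) : Set (CCtx × Store) :=
  {Eτ | CT Eτ.1.fv Eτ.2 ∧
    ∀ V τ', (V, τ') ∈ S → Compat Eτ.2 τ' → P.ortho (ofW V) τ' (ofC Eτ.1) Eτ.2}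

/-- Terms orthogonal to a set of catchable contexts. -/
def orthtE (P : Pole) (S : Set (CCtx × Store)) : Set (Trm × Store) :=
  {tτ | CT tτ.1.fv tτ.2 ∧
    ∀ E τ', (E, τ') ∈ S → Compat tτ.2 τ' → P.ortho tτ.1 tτ.2 (ofC E) τ'}

/-- Evaluation contexts orthogonal to a set of terms. -/
def orthet (P : Pole) (S : Set (Trm × Store)) : Set (ECtx × Store) :=
  {eτ | CT eτ.1.fv eτ.2 ∧
    ∀ t τ', (t, τ') ∈ S → Compat eτ.2 τ' → P.ortho t τ' eτ.1 eτ.2}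

/-- The realizer sets |A|_v at strong-value level, by induction on A. -/
def Realv (cs : ℕ → ℕ) (P : Pole) : Ty → Set (SVal × Store)
  | .atom n => {vτ | CT vτ.1.fv vτ.2 ∧ ∃ k, vτ.1 = .const k ∧ cs k = n}
  | .arrow A B =>
    {vτ | CT vτ.1.fv vτ.2 ∧ ∃ x t, vτ.1 = .lam x t ∧
      ∀ u τ', Compat vτ.2 τ' →
        (u, τ') ∈ orthtE P (orthEV P (orthVF P (orthFv P (Realv cs P A)))) →
        (t, .consT (vτ.2.join τ') x u) ∈
          orthtE P (orthEV P (orthVF P (orthFv P (Realv cs P B))))}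

/-- ‖A‖_F. -/
def RealF (cs : ℕ → ℕ) (P : Pole) (A : Ty) : Set (FCtx × Store) :=
  orthFv P (Realv cs P A)
/-- |A|_V. -/
def RealV (cs : ℕ → ℕ) (P : Pole) (A : Ty) : Set (WVal × Store) :=
  orthVF P (RealF cs P A)
/-- ‖A‖_E. -/
def RealE (cs : ℕ → ℕ) (P : Pole) (A : Ty) : Set (CCtx × Store) :=
  orthEV P (RealV cs P A)
/-- |A|_t. -/
def Realt (cs : ℕ → ℕ) (P : Pole) (A : Ty) : Set (Trm × Store) :=
  orthtE P (RealE cs P A)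
/-- ‖A‖_e. -/
def Reale (cs : ℕ → ℕ) (P : Pole) (A : Ty) : Set (ECtx × Store) :=
  orthet P (Realt cs P A)

/-- τ ⊨ Γ : the closed store τ realizes the typing context Γ. -/
def RealsCtx (cs : ℕ → ℕ) (P : Pole) (τ : Store) (Γ : Ctx) : Prop :=
  τ.Closed ∧
  (∀ x A, CEntry.tv x A ∈ Γ →
    ∃ τ₀ t τ₁, τ = (Store.consT τ₀ x t).app τ₁ ∧ (t, τ₀) ∈ Realt cs P A) ∧
  (∀ α A, CEntry.cv α A ∈ Γ →
    ∃ τ₀ E τ₁, τ = (Store.consE τ₀ α E).app τ₁ ∧ (E, τ₀) ∈ RealE cs P A)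

end LLV

namespace LLV

namespace Bnd

/-- The term or catchable context carried by a binding. -/
def val : Bnd → Trm ⊕ CCtx
  | .bt _ t => Sum.inl t
  | .be _ E => Sum.inr E

/-- The free variables of the body of a binding. -/
def fv : Bnd → Finset (ℕ ⊕ ℕ)
  | .bt _ t => t.fv
  | .be _ E => E.fv

end Bnd

namespace Store

/-- Extension of a store by one binding. -/
def snoc (τ : Store) : Bnd → Store
  | .bt x t => .consT τ x t
  | .be α E => .consE τ α E

theorem ofL_append_singleton (l : List Bnd) (b : Bnd) : ofL (l ++ [b]) = (ofL l).snoc b := by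
  cases b <;> simp [ofL, snoc]

theorem ofL_toL : ∀ τ : Store, ofL τ.toL = τ
  | .nil => rfl
  | .consT τ x t => by rw [toL, ofL_append_singleton, ofL_toL τ, snoc]
  | .consE τ α E => by rw [toL, ofL_append_singleton, ofL_toL τ, snoc]

theorem dom_snoc (τ : Store) (b : Bnd) : (τ.snoc b).dom = insert b.key τ.dom := by
  cases b <;> rfl

theorem lookup_snoc (τ : Store) (b : Bnd) (k : ℕ ⊕ ℕ) :
    (τ.snoc b).lookup k = if k = b.key then some b.val else τ.lookup k := by
  cases b <;> rfl

theorem closed_snoc (τ : Store) (b : Bnd) :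
    (τ.snoc b).Closed ↔ τ.Closed ∧ b.fv ⊆ τ.dom := by
  cases b <;>
    simp [snoc, Closed, fv, Bnd.fv, Finset.union_eq_empty, Finset.sdiff_eq_empty_iff_subset]

theorem mem_dom_iff_isSome_lookup (k : ℕ ⊕ ℕ) : ∀ τ : Store, k ∈ τ.dom ↔ (τ.lookup k).isSome
  | .nil => by simp [dom, lookup]
  | .consT τ x t => by
      have := mem_dom_iff_isSome_lookup k τ
      by_cases h : k = Sum.inl x <;> simp [dom, lookup, h, this]
  | .consE τ α E => by
      have := mem_dom_iff_isSome_lookup k τ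
      by_cases h : k = Sum.inr α <;> simp [dom, lookup, h, this]

theorem mem_dom_ofL (l : List Bnd) (k : ℕ ⊕ ℕ) : k ∈ (ofL l).dom ↔ k ∈ l.map Bnd.key := by
  induction l using List.reverseRecOn with
  | nil => simp [ofL, dom]
  | append_singleton l b ih =>
    rw [ofL_append_singleton, dom_snoc, Finset.mem_insert, ih]
    simp [or_comm]

theorem lookup_ofL_append (l m : List Bnd) (k : ℕ ⊕ ℕ) :
    (ofL (l ++ m)).lookup k = ((ofL m).lookup k).or ((ofL l).lookup k) := by
  induction m using List.reverseRecOn with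
  | nil => simp [ofL, lookup]
  | append_singleton m b ih =>
    rw [← List.append_assoc, ofL_append_singleton, ofL_append_singleton, lookup_snoc, lookup_snoc,
      ih]
    split <;> simp

theorem lookup_ofL_cons (b : Bnd) (l : List Bnd) (k : ℕ ⊕ ℕ) :
    (ofL (b :: l)).lookup k =
      ((ofL l).lookup k).or (if k = b.key then some b.val else none) := by
  have h := lookup_ofL_append [b] l k
  rw [← List.nil_append [b], ofL_append_singleton, lookup_snoc] at h
  exact h

theorem lookup_ofL_eq_none {l : List Bnd} {k : ℕ ⊕ ℕ} :
    (ofL l).lookup k = none ↔ k ∉ l.map Bnd.key := by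
  rw [← mem_dom_ofL, mem_dom_iff_isSome_lookup]
  simp

end Store

theorem splitAtKey_eq_none {k : ℕ ⊕ ℕ} {l : List Bnd} (h : splitAtKey k l = none) :
    k ∉ l.map Bnd.key := by
  induction l with
  | nil => simp
  | cons b l ih =>
    rw [splitAtKey] at h
    split at h
    · simp at h
    · rename_i hb
      rw [List.map_cons, List.mem_cons, not_or]
      exact ⟨fun e => hb e.symm, ih (by simpa using h)⟩

theorem splitAtKey_eq_some {k : ℕ ⊕ ℕ} {l p s : List Bnd} (h : splitAtKey k l = some (p, s)) :
    k ∉ p.map Bnd.key ∧ ∃ b, b.key = k ∧ l = p ++ b :: s := by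
  induction l generalizing p with
  | nil => simp [splitAtKey] at h
  | cons b l ih =>
    rw [splitAtKey] at h
    split at h
    · rename_i hb
      simp only [Option.some.injEq, Prod.mk.injEq] at h
      obtain ⟨rfl, rfl⟩ := h
      exact ⟨by simp, b, hb, rfl⟩
    · rename_i hb
      simp only [Option.map_eq_some_iff, Prod.mk.injEq, Prod.exists] at h
      obtain ⟨q, s', h, rfl, rfl⟩ := h
      obtain ⟨hq, b', hb', rfl⟩ := ih h
      refine ⟨?_, b', hb', rfl⟩
      rw [List.map_cons, List.mem_cons, not_or]
      exact ⟨fun e => hb e.symm, hq⟩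

theorem mem_keys_joinL (l l' : List Bnd) (k : ℕ ⊕ ℕ) :
    k ∈ (joinL l l').map Bnd.key ↔ k ∈ l.map Bnd.key ∨ k ∈ l'.map Bnd.key := by
  induction l generalizing l' with
  | nil => simp [joinL]
  | cons b l ih =>
    rw [joinL]
    split
    · rename_i p s h
      obtain ⟨-, b', hb', rfl⟩ := splitAtKey_eq_some h
      simp only [List.map_append, List.map_cons, List.mem_append, List.mem_cons, ih, hb']
      tauto
    · simp only [List.map_cons, List.mem_cons, ih]
      tauto

/-- A lookup in the join of two lists of bindings agrees with a lookup in one of the two lists. -/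
theorem lookup_joinL (l l' : List Bnd) (k : ℕ ⊕ ℕ) :
    (Store.ofL (joinL l l')).lookup k = (Store.ofL l).lookup k ∨
      (Store.ofL (joinL l l')).lookup k = (Store.ofL l').lookup k := by
  induction l generalizing l' with
  | nil => exact Or.inr (by rw [joinL])
  | cons b l ih =>
    have none_iff (m : List Bnd) : (Store.ofL (joinL l m)).lookup k = none ↔
        (Store.ofL l).lookup k = none ∧ (Store.ofL m).lookup k = none := by
      simp only [Store.lookup_ofL_eq_none, mem_keys_joinL, not_or]
    rw [joinL]
    split
    · rename_i p s h
      obtain ⟨hp, b', hb', rfl⟩ := splitAtKey_eq_some h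
      rw [← Store.lookup_ofL_eq_none] at hp
      have hn := none_iff s
      have ho := ih s
      clear none_iff ih
      simp only [Store.lookup_ofL_append, Store.lookup_ofL_cons, hb']
      generalize (Store.ofL (joinL l s)).lookup k = o at hn ho ⊢
      generalize (Store.ofL l).lookup k = o₁ at hn ho ⊢
      generalize (Store.ofL s).lookup k = o₂ at hn ho ⊢
      by_cases hk : k = b.key
      · subst hk
        rcases o with _ | o <;> rcases o₁ with _ | o₁ <;> rcases o₂ with _ | o₂ <;> simp_all
      · rcases o with _ | o <;> rcases o₁ with _ | o₁ <;> rcases o₂ with _ | o₂ <;> simp_all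
    · rename_i h
      have hl' := splitAtKey_eq_none h
      rw [← Store.lookup_ofL_eq_none] at hl'
      have hn := none_iff l'
      have ho := ih l'
      clear none_iff ih
      simp only [Store.lookup_ofL_cons]
      by_cases hk : k = b.key
      · subst hk
        rw [hl'] at hn ho ⊢
        generalize (Store.ofL (joinL l l')).lookup b.key = o at hn ho ⊢
        rcases o with _ | o <;> simp_all
      · simpa only [hk, if_false, Option.or_none] using ho

/-- Every binding of the list has its free variables in `D` or among the earlier keys. -/
def ClosedOver (D : Set (ℕ ⊕ ℕ)) : List Bnd → Prop
  | [] => True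
  | b :: l => ↑b.fv ⊆ D ∧ ClosedOver (insert b.key D) l

theorem ClosedOver.mono {D D' : Set (ℕ ⊕ ℕ)} {l : List Bnd} (h : ClosedOver D l)
    (hD : D ⊆ D') : ClosedOver D' l := by
  induction l generalizing D D' with
  | nil => trivial
  | cons b l ih => exact ⟨h.1.trans hD, ih h.2 (Set.insert_subset_insert hD)⟩

theorem closedOver_append {D : Set (ℕ ⊕ ℕ)} {l m : List Bnd} :
    ClosedOver D (l ++ m) ↔ ClosedOver D l ∧ ClosedOver (D ∪ {k | k ∈ l.map Bnd.key}) m := by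
  induction l generalizing D with
  | nil => simp [ClosedOver]
  | cons b l ih =>
    have : insert b.key D ∪ {k | k ∈ l.map Bnd.key} = D ∪ {k | k ∈ (b :: l).map Bnd.key} := by
      ext k
      simp only [Set.mem_union, Set.mem_insert_iff, Set.mem_ofPred_eq, List.map_cons,
        List.mem_cons]
      tauto
    rw [List.cons_append, ClosedOver, ClosedOver, ih, this, and_assoc]

theorem closed_ofL_iff (l : List Bnd) : (Store.ofL l).Closed ↔ ClosedOver ∅ l := by
  induction l using List.reverseRecOn with
  | nil => simp [Store.ofL, Store.Closed, Store.fv, ClosedOver]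
  | append_singleton l b ih =>
    have : (b.fv ⊆ (Store.ofL l).dom) ↔
        (↑b.fv : Set (ℕ ⊕ ℕ)) ⊆ ∅ ∪ {k | k ∈ l.map Bnd.key} := by
      simp only [Finset.subset_iff, Set.subset_def, Store.mem_dom_ofL, Finset.mem_coe,
        Set.empty_union, Set.mem_ofPred_eq]
    rw [Store.ofL_append_singleton, Store.closed_snoc, closedOver_append, ih, this, ClosedOver,
      ClosedOver, and_true]

theorem ClosedOver.joinL {D : Set (ℕ ⊕ ℕ)} {l l' : List Bnd} (hl : ClosedOver D l)
    (hl' : ClosedOver D l') : ClosedOver D (joinL l l') := by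
  induction l generalizing D l' with
  | nil => rwa [LLV.joinL]
  | cons b l ih =>
    rw [LLV.joinL]
    split
    · rename_i p s h
      obtain ⟨-, b', hb', rfl⟩ := splitAtKey_eq_some h
      rw [closedOver_append, ClosedOver, hb'] at hl'
      rw [closedOver_append, ClosedOver]
      exact ⟨hl'.1, hl.1.trans Set.subset_union_left,
        ih (hl.2.mono (Set.insert_subset_insert Set.subset_union_left)) hl'.2.2⟩
    · exact ⟨hl.1, ih hl.2 (hl'.mono (Set.subset_insert _ _))⟩

namespace Store

theorem Closed.join {τ τ' : Store} (h : τ.Closed) (h' : τ'.Closed) : (τ.join τ').Closed := by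
  rw [← ofL_toL τ, closed_ofL_iff] at h
  rw [← ofL_toL τ', closed_ofL_iff] at h'
  exact (closed_ofL_iff _).2 (h.joinL h')

theorem dom_join (τ τ' : Store) : (τ.join τ').dom = τ.dom ∪ τ'.dom := by
  ext k
  rw [join, mem_dom_ofL, mem_keys_joinL, ← mem_dom_ofL, ← mem_dom_ofL, ofL_toL, ofL_toL,
    Finset.mem_union]

theorem lookup_join (τ τ' : Store) (k : ℕ ⊕ ℕ) :
    (τ.join τ').lookup k = τ.lookup k ∨ (τ.join τ').lookup k = τ'.lookup k := by
  simpa only [join, ofL_toL] using lookup_joinL τ.toL τ'.toL k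

theorem lookup_join_left {τ τ' : Store} (h : Compat τ τ') {k : ℕ ⊕ ℕ} (hk : k ∈ τ.dom) :
    (τ.join τ').lookup k = τ.lookup k := by
  rcases lookup_join τ τ' k with e | e
  · exact e
  · have hj : k ∈ (τ.join τ').dom := by rw [dom_join]; exact Finset.mem_union_left _ hk
    rw [mem_dom_iff_isSome_lookup, e, ← mem_dom_iff_isSome_lookup] at hj
    rw [e, h k hk hj]

theorem lookup_join_right {τ τ' : Store} (h : Compat τ τ') {k : ℕ ⊕ ℕ} (hk : k ∈ τ'.dom) :
    (τ.join τ').lookup k = τ'.lookup k := by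
  rcases lookup_join τ τ' k with e | e
  · have hj : k ∈ (τ.join τ').dom := by rw [dom_join]; exact Finset.mem_union_right _ hk
    rw [mem_dom_iff_isSome_lookup, e, ← mem_dom_iff_isSome_lookup] at hj
    rw [e, h k hj hk]
  · exact e

end Store

theorem Compat.symm {τ τ' : Store} (h : Compat τ τ') : Compat τ' τ :=
  fun k hk hk' => (h k hk' hk).symm

namespace Ext

variable {τ τ' σ : Store}

theorem compat (h : Ext τ τ') (hc : Compat τ' σ) : Compat τ σ :=
  fun k hk hk' => (h.2 k hk (h.1 hk)).trans (hc k (h.1 hk) hk')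

theorem join_right (h : Ext τ τ') (hc : Compat τ' σ) : Ext (τ.join σ) (τ'.join σ) := by
  refine ⟨?_, fun k hk _ => ?_⟩
  · rw [Store.dom_join, Store.dom_join]
    exact Finset.union_subset_union_left h.1
  · rw [Store.dom_join, Finset.mem_union] at hk
    rcases hk with hk | hk
    · rw [Store.lookup_join_left (h.compat hc) hk, Store.lookup_join_left hc (h.1 hk),
        h.2 k hk (h.1 hk)]
    · rw [Store.lookup_join_right (h.compat hc) hk, Store.lookup_join_right hc hk]

theorem join_left (h : Ext τ τ') (hc : Compat τ' σ) : Ext (σ.join τ) (σ.join τ') := by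
  refine ⟨?_, fun k hk _ => ?_⟩
  · rw [Store.dom_join, Store.dom_join]
    exact Finset.union_subset_union_right h.1
  · rw [Store.dom_join, Finset.mem_union] at hk
    rcases hk with hk | hk
    · rw [Store.lookup_join_left (h.compat hc).symm hk, Store.lookup_join_left hc.symm hk]
    · rw [Store.lookup_join_right (h.compat hc).symm hk,
        Store.lookup_join_right hc.symm (h.1 hk), h.2 k hk (h.1 hk)]

theorem consT (h : Ext τ τ') (x : ℕ) (u : Trm) : Ext (.consT τ x u) (.consT τ' x u) := by
  refine ⟨Finset.insert_subset_insert _ h.1, fun k hk _ => ?_⟩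
  rw [Store.lookup, Store.lookup]
  split
  · rfl
  · rename_i hx
    have hk := (Finset.mem_insert.1 hk).resolve_left hx
    exact h.2 k hk (h.1 hk)

end Ext

theorem CT.weaken {fv : Finset (ℕ ⊕ ℕ)} {τ τ' : Store} (h : CT fv τ) (hτ' : τ'.Closed)
    (he : Ext τ τ') : CT fv τ' :=
  ⟨hτ', h.2.trans he.1⟩

namespace Pole.ortho

variable {P : Pole} {t : Trm} {e : ECtx} {τ τ' σ : Store}

theorem weaken_left (h : P.ortho t τ e σ) (hτ' : τ'.Closed) (hσ : σ.Closed) (he : Ext τ τ')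
    (hc : Compat τ' σ) : P.ortho t τ' e σ :=
  ⟨hc, P.store_ext _ _ _ h.2 (he.join_right hc) (hτ'.join hσ)⟩

theorem weaken_right (h : P.ortho t σ e τ) (hτ' : τ'.Closed) (hσ : σ.Closed) (he : Ext τ τ')
    (hc : Compat τ' σ) : P.ortho t σ e τ' :=
  ⟨hc.symm, P.store_ext _ _ _ h.2 (he.join_left hc) (hσ.join hτ')⟩

end Pole.ortho

section weakening

variable {cs : ℕ → ℕ} {P : Pole} {A : Ty} {τ τ' : Store}

theorem Realv.ct {v : SVal} (h : (v, τ) ∈ Realv cs P A) : CT v.fv τ := by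
  cases A <;> exact h.1

theorem Realt.weaken {t : Trm} (h : (t, τ) ∈ Realt cs P A) (hτ' : τ'.Closed) (he : Ext τ τ') :
    (t, τ') ∈ Realt cs P A :=
  ⟨h.1.weaken hτ' he, fun E σ hE hc =>
    (h.2 E σ hE (he.compat hc)).weaken_left hτ' hE.1.1 he hc⟩

theorem Reale.weaken {e : ECtx} (h : (e, τ) ∈ Reale cs P A) (hτ' : τ'.Closed) (he : Ext τ τ') :
    (e, τ') ∈ Reale cs P A :=
  ⟨h.1.weaken hτ' he, fun t σ ht hc =>
    (h.2 t σ ht (he.compat hc)).weaken_right hτ' ht.1.1 he hc⟩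

theorem RealE.weaken {E : CCtx} (h : (E, τ) ∈ RealE cs P A) (hτ' : τ'.Closed) (he : Ext τ τ') :
    (E, τ') ∈ RealE cs P A :=
  ⟨h.1.weaken hτ' he, fun V σ hV hc =>
    (h.2 V σ hV (he.compat hc)).weaken_right hτ' hV.1.1 he hc⟩

theorem RealV.weaken {V : WVal} (h : (V, τ) ∈ RealV cs P A) (hτ' : τ'.Closed) (he : Ext τ τ') :
    (V, τ') ∈ RealV cs P A :=
  ⟨h.1.weaken hτ' he, fun F σ hF hc =>
    (h.2 F σ hF (he.compat hc)).weaken_left hτ' hF.1.1 he hc⟩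

theorem RealF.weaken {F : FCtx} (h : (F, τ) ∈ RealF cs P A) (hτ' : τ'.Closed) (he : Ext τ τ') :
    (F, τ') ∈ RealF cs P A :=
  ⟨h.1.weaken hτ' he, fun v σ hv hc =>
    (h.2 v σ hv (he.compat hc)).weaken_right hτ' (Realv.ct hv).1 he hc⟩

theorem Realv.weaken {v : SVal} (h : (v, τ) ∈ Realv cs P A) (hτ' : τ'.Closed) (he : Ext τ τ') :
    (v, τ') ∈ Realv cs P A := by
  cases A with
  | atom n => exact ⟨h.1.weaken hτ' he, h.2⟩
  | arrow A B =>
    obtain ⟨hct, x, t, hv, h⟩ := h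
    refine ⟨hct.weaken hτ' he, x, t, hv, fun u σ hc hu => ?_⟩
    have hcl : (Store.consT (τ'.join σ) x u).Closed := by
      refine (Store.closed_snoc (τ'.join σ) (.bt x u)).2 ⟨hτ'.join hu.1.1, ?_⟩
      rw [Store.dom_join]
      exact hu.1.2.trans Finset.subset_union_right
    exact Realt.weaken (A := B) (h u σ (he.compat hc) hu) hcl ((he.join_right hc).consT x u)

end weakening

/-- Store weakening for realizers: if τ ◁ τ′ are closed stores then realizers
over τ are realizers over τ′, at each of the levels t, e, E, V, F, v. -/
theorem store_weakening_realizers (cs : ℕ → ℕ) (P : Pole) (A : Ty)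
    (τ τ' : Store) (hτ : τ.Closed) (hτ' : τ'.Closed) (he : Ext τ τ') :
    (∀ t : Trm, (t, τ) ∈ Realt cs P A → (t, τ') ∈ Realt cs P A) ∧
    (∀ e : ECtx, (e, τ) ∈ Reale cs P A → (e, τ') ∈ Reale cs P A) ∧
    (∀ E : CCtx, (E, τ) ∈ RealE cs P A → (E, τ') ∈ RealE cs P A) ∧
    (∀ V : WVal, (V, τ) ∈ RealV cs P A → (V, τ') ∈ RealV cs P A) ∧
    (∀ F : FCtx, (F, τ) ∈ RealF cs P A → (F, τ') ∈ RealF cs P A) ∧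
    (∀ v : SVal, (v, τ) ∈ Realv cs P A → (v, τ') ∈ Realv cs P A) :=
  ⟨fun _ h => Realt.weaken h hτ' he, fun _ h => Reale.weaken h hτ' he,
    fun _ h => RealE.weaken h hτ' he, fun _ h => RealV.weaken h hτ' he,
    fun _ h => RealF.weaken h hτ' he, fun _ h => Realv.weaken h hτ' he⟩

end LLV
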